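/- For every real constant a > −1/2 and every b ∈ ℝ, the double integral over ℝ² of exp{−(1/2)(λ₁² + λ₂²) − (a/2)(λ₁ + λ₂)²} · |λ₁ − b| · |λ₂ − b| · |λ₁ − λ₂| · 1{λ₁ < λ₂ < b} with respect to (λ₁, λ₂) equals (√(2π)/√(1+a)) · exp(−((1+2a)/(2(1+a)))·b²) · Φ(((1+2a)/√(1+a))·b) + (2b² − (1+4a)/(1+2a)) · (√π/√(1+2a)) · Φ(√(2(1+2a))·b) + (b/(1+2a)) · exp(−(1+2a)·b²). -/

import Mathlib

open MeasureTheory Real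

/-- The standard Gaussian cumulative distribution function. -/
noncomputable def stdGaussCDF (x : ℝ) : ℝ :=
  ∫ y in Set.Iic x, Real.exp (-y ^ 2 / 2) / Real.sqrt (2 * Real.pi)

/-- A rescaled Gaussian integral over a half-line, in terms of the Gaussian distribution function. -/
lemma integral_Iic_exp_neg_mul_sub_sq {k : ℝ} (hk : 0 < k) (m b : ℝ) :
    ∫ t in Set.Iic b, exp (-k * (t - m) ^ 2) = √(π / k) * stdGaussCDF (√(2 * k) * (b - m)) := by
  have hs : 0 < √(2 * k) := by positivity
  have hs2 : √(2 * k) ^ 2 = 2 * k := sq_sqrt (by positivity)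
  set g : ℝ → ℝ := (Set.Iic (√(2 * k) * (b - m))).indicator
    fun y => exp (-y ^ 2 / 2) / √(2 * π) with hg
  have hcdf : stdGaussCDF (√(2 * k) * (b - m)) = ∫ y, g y := by
    rw [stdGaussCDF, hg, integral_indicator measurableSet_Iic]
  have hpt (t : ℝ) : (Set.Iic b).indicator (fun t => exp (-k * (t - m) ^ 2)) t
      = √(2 * π) * g (√(2 * k) * (t - m)) := by
    have hmem : √(2 * k) * (t - m) ≤ √(2 * k) * (b - m) ↔ t ≤ b := by
      rw [mul_le_mul_iff_right₀ hs]; simp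
    have hpi : √(2 * π) ≠ 0 := by positivity
    by_cases h : t ≤ b
    · rw [hg, Set.indicator_of_mem (Set.mem_Iic.2 h), Set.indicator_of_mem (Set.mem_Iic.2 (hmem.2 h)),
        mul_pow, hs2]
      field_simp
    · rw [hg, Set.indicator_of_notMem (by simpa using h),
        Set.indicator_of_notMem (by rwa [Set.mem_Iic, hmem]), mul_zero]
  rw [← integral_indicator measurableSet_Iic, integral_congr_ae (ae_of_all _ hpt),
    integral_const_mul, integral_sub_right_eq_self (fun t => g (√(2 * k) * t)),
    Measure.integral_comp_mul_left, hcdf, smul_eq_mul, abs_of_pos (inv_pos.2 hs), ← mul_assoc,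
    ← div_eq_mul_inv, ← sqrt_div (by positivity)]
  congr 2
  exact mul_div_mul_left π k two_ne_zero

lemma integrable_sq_mul_exp_neg_mul_sq {c : ℝ} (hc : 0 < c) :
    Integrable fun t : ℝ => t ^ 2 * exp (-c * t ^ 2) := by
  simpa using integrable_rpow_mul_exp_neg_mul_sq hc (s := 2) (by norm_num)

lemma integrable_quadratic_mul_exp_neg_mul_sq {c : ℝ} (hc : 0 < c) (p q r : ℝ) :
    Integrable fun t : ℝ => (p + q * t + r * t ^ 2) * exp (-c * t ^ 2) := by
  refine ((((integrable_exp_neg_mul_sq hc).const_mul p).add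
    ((integrable_mul_exp_neg_mul_sq hc).const_mul q)).add
    ((integrable_sq_mul_exp_neg_mul_sq hc).const_mul r)).congr (ae_of_all _ fun t => ?_)
  simp only [Pi.add_apply]
  ring

/-- Integration by parts for an affine function against a Gaussian on a half-line. -/
lemma integral_Iic_deriv_affine_mul_exp_neg_mul_sq {c : ℝ} (hc : 0 < c) (p q b : ℝ) :
    ∫ t in Set.Iic b, (q + (-2 * c * p) * t + (-2 * c * q) * t ^ 2) * exp (-c * t ^ 2)
      = (p + q * b) * exp (-c * b ^ 2) := by
  have hderiv (t : ℝ) : HasDerivAt (fun t => (p + q * t) * exp (-c * t ^ 2))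
      ((q + (-2 * c * p) * t + (-2 * c * q) * t ^ 2) * exp (-c * t ^ 2)) t := by
    have h1 : HasDerivAt (fun t : ℝ => p + q * t) q t := by
      simpa using ((hasDerivAt_id t).const_mul q).const_add p
    have h2 : HasDerivAt (fun t : ℝ => -c * t ^ 2) (-c * (2 * t)) t := by
      simpa using (hasDerivAt_pow 2 t).const_mul (-c)
    exact (h1.mul h2.exp).congr_deriv (by ring)
  have hint := (integrable_quadratic_mul_exp_neg_mul_sq hc q (-2 * c * p) (-2 * c * q)).integrableOn
    (s := Set.Iic b)
  have hint0 : IntegrableOn (fun t => (p + q * t) * exp (-c * t ^ 2)) (Set.Iic b) := by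
    simpa using (integrable_quadratic_mul_exp_neg_mul_sq hc p q 0).integrableOn (s := Set.Iic b)
  simpa using integral_Iic_of_hasDerivAt_of_tendsto' (fun t _ => hderiv t) hint
    (tendsto_zero_of_hasDerivAt_of_integrableOn_Iic (fun t _ => hderiv t) hint hint0)

lemma integral_exp_neg_sq_div_four_mul (w : ℝ) :
    ∫ s in (0 : ℝ)..(2 * w), exp (-s ^ 2 / 4) * (w ^ 2 - s ^ 2 / 4) * s
      = 2 * (w ^ 2 - 1 + exp (-w ^ 2)) := by
  have hderiv (s : ℝ) : HasDerivAt (fun s : ℝ => 2 * (s ^ 2 / 4 - w ^ 2 + 1) * exp (-s ^ 2 / 4))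
      (exp (-s ^ 2 / 4) * (w ^ 2 - s ^ 2 / 4) * s) s := by
    have h0 : HasDerivAt (fun s : ℝ => s ^ 2) (2 * s) s := by simpa using hasDerivAt_pow 2 s
    have h1 := (((h0.div_const 4).sub_const (w ^ 2)).add_const 1).const_mul 2
    exact (h1.mul (h0.neg.div_const 4).exp).congr_deriv (by simp only [Pi.neg_apply]; ring)
  rw [intervalIntegral.integral_eq_sub_of_hasDerivAt (fun s _ => hderiv s)
    (Continuous.intervalIntegrable (by fun_prop) _ _)]
  have : -(2 * w) ^ 2 / 4 = -w ^ 2 := by ring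
  rw [this]
  norm_num
  ring

/-- The change of variables to midpoint and difference preserves Lebesgue measure. -/
lemma measurePreserving_midpoint_difference :
    MeasurePreserving (fun p : ℝ × ℝ => (p.1 - p.2 / 2, p.1 + p.2 / 2)) := by
  have h1 : MeasurePreserving (fun p : ℝ × ℝ => (p.1, p.2 - p.1 / 2))
      (volume.prod volume) (volume.prod volume) :=
    (MeasurePreserving.id volume).skew_product (g := fun s t => t - s / 2) (by fun_prop)
      (ae_of_all _ fun s => (measurePreserving_sub_right volume (s / 2)).map_eq)
  have h2 := (measurePreserving_prod_add (volume : Measure ℝ) (volume : Measure ℝ)).comp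
    (Measure.measurePreserving_swap.comp (h1.comp Measure.measurePreserving_swap))
  rw [← Measure.volume_eq_prod] at h2
  convert h2 using 1
  ext p
  · simp
  · simp only [Function.comp_apply, Prod.swap]
    ring

/-- The integrand in midpoint and difference coordinates. -/
noncomputable def gapIntegrand (c b : ℝ) (p : ℝ × ℝ) : ℝ :=
  {q : ℝ × ℝ | 0 < q.2 ∧ q.2 < 2 * (b - q.1)}.indicator
    (fun q => exp (-c * q.1 ^ 2) *
      (exp (-q.2 ^ 2 / 4) * ((b - q.1) ^ 2 - q.2 ^ 2 / 4) * q.2)) p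

lemma measurable_gapIntegrand (c b : ℝ) : Measurable (gapIntegrand c b) := by
  refine Measurable.indicator (by fun_prop) ?_
  exact (measurableSet_lt measurable_const measurable_snd).inter
    (measurableSet_lt measurable_snd ((measurable_const.sub measurable_fst).const_mul 2))

lemma gapIntegrand_nonneg (c b : ℝ) (p : ℝ × ℝ) : 0 ≤ gapIntegrand c b p := by
  refine Set.indicator_nonneg (fun q hq => ?_) p
  obtain ⟨h0, h1⟩ := hq
  have : 0 ≤ (b - q.1) ^ 2 - q.2 ^ 2 / 4 := by nlinarith
  positivity

lemma gapIntegrand_eq_indicator_Ioo (c b t : ℝ) :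
    (fun s => gapIntegrand c b (t, s)) = (Set.Ioo 0 (2 * (b - t))).indicator fun s =>
      exp (-c * t ^ 2) * (exp (-s ^ 2 / 4) * ((b - t) ^ 2 - s ^ 2 / 4) * s) := by
  ext s
  rfl

lemma integrable_gapIntegrand_fiber (c b t : ℝ) :
    Integrable fun s => gapIntegrand c b (t, s) := by
  rw [gapIntegrand_eq_indicator_Ioo, integrable_indicator_iff measurableSet_Ioo]
  exact (Continuous.integrableOn_Icc (by fun_prop)).mono_set Set.Ioo_subset_Icc_self

lemma integral_gapIntegrand_fiber (c b t : ℝ) :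
    ∫ s, gapIntegrand c b (t, s) = (Set.Iic b).indicator
      (fun t => exp (-c * t ^ 2) * (2 * ((b - t) ^ 2 - 1 + exp (-(b - t) ^ 2)))) t := by
  rw [gapIntegrand_eq_indicator_Ioo, integral_indicator measurableSet_Ioo]
  by_cases h : t ≤ b
  · rw [Set.indicator_of_mem (Set.mem_Iic.2 h), ← integral_Ioc_eq_integral_Ioo,
      ← intervalIntegral.integral_of_le (by linarith), intervalIntegral.integral_const_mul,
      integral_exp_neg_sq_div_four_mul]
  · rw [Set.indicator_of_notMem (by simpa using h), Set.Ioo_eq_empty (by linarith)]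
    simp

lemma integrable_exp_neg_mul_sub_sq {k : ℝ} (hk : 0 < k) (m : ℝ) :
    Integrable fun t : ℝ => exp (-k * (t - m) ^ 2) :=
  (integrable_exp_neg_mul_sq hk).comp_sub_right m

lemma exp_mul_gap_profile {c : ℝ} (hc : 0 < c) (b t : ℝ) :
    exp (-c * t ^ 2) * (2 * ((b - t) ^ 2 - 1 + exp (-(b - t) ^ 2)))
      = (-1 / c + (-2 * c * (2 * b / c)) * t + (-2 * c * (-1 / c)) * t ^ 2) * exp (-c * t ^ 2)
        + (2 * b ^ 2 - 2 + 1 / c) * exp (-c * (t - 0) ^ 2)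
        + 2 * exp (-(c / (c + 1)) * b ^ 2) * exp (-(c + 1) * (t - b / (c + 1)) ^ 2) := by
  have h : exp (-(c / (c + 1)) * b ^ 2) * exp (-(c + 1) * (t - b / (c + 1)) ^ 2)
      = exp (-c * t ^ 2) * exp (-(b - t) ^ 2) := by
    rw [← exp_add, ← exp_add]
    congr 1
    field_simp
    ring
  rw [mul_assoc 2, h, sub_zero]
  field_simp
  ring

lemma integrable_exp_mul_gap_profile {c : ℝ} (hc : 0 < c) (b : ℝ) :
    Integrable fun t : ℝ => exp (-c * t ^ 2) * (2 * ((b - t) ^ 2 - 1 + exp (-(b - t) ^ 2))) := by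
  simp_rw [exp_mul_gap_profile hc b]
  exact ((integrable_quadratic_mul_exp_neg_mul_sq hc _ _ _).add
    ((integrable_exp_neg_mul_sub_sq hc 0).const_mul _)).add
    ((integrable_exp_neg_mul_sub_sq (by positivity) _).const_mul _)

lemma integral_Iic_exp_mul_gap_profile {c : ℝ} (hc : 0 < c) (b : ℝ) :
    ∫ t in Set.Iic b, exp (-c * t ^ 2) * (2 * ((b - t) ^ 2 - 1 + exp (-(b - t) ^ 2)))
      = (2 * b / c + -1 / c * b) * exp (-c * b ^ 2)
        + (2 * b ^ 2 - 2 + 1 / c) * (√(π / c) * stdGaussCDF (√(2 * c) * (b - 0)))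
        + 2 * exp (-(c / (c + 1)) * b ^ 2) * (√(π / (c + 1)) *
          stdGaussCDF (√(2 * (c + 1)) * (b - b / (c + 1)))) := by
  have hc1 : 0 < c + 1 := by positivity
  have i1 := (integrable_quadratic_mul_exp_neg_mul_sq hc (-1 / c) (-2 * c * (2 * b / c))
    (-2 * c * (-1 / c))).integrableOn (s := Set.Iic b)
  have i2 := ((integrable_exp_neg_mul_sub_sq hc 0).const_mul
    (2 * b ^ 2 - 2 + 1 / c)).integrableOn (s := Set.Iic b)
  have i3 := ((integrable_exp_neg_mul_sub_sq hc1 (b / (c + 1))).const_mul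
    (2 * exp (-(c / (c + 1)) * b ^ 2))).integrableOn (s := Set.Iic b)
  simp_rw [exp_mul_gap_profile hc b]
  rw [integral_add (by exact i1.add i2) i3, integral_add i1 i2, integral_const_mul, integral_const_mul,
    integral_Iic_deriv_affine_mul_exp_neg_mul_sq hc, integral_Iic_exp_neg_mul_sub_sq hc,
    integral_Iic_exp_neg_mul_sub_sq hc1]

lemma integrable_gapIntegrand {c : ℝ} (hc : 0 < c) (b : ℝ) : Integrable (gapIntegrand c b) := by
  refine (integrable_prod_iff (measurable_gapIntegrand c b).aestronglyMeasurable).2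
    ⟨ae_of_all _ (integrable_gapIntegrand_fiber c b), ?_⟩
  simp_rw [norm_of_nonneg (gapIntegrand_nonneg c b _), integral_gapIntegrand_fiber]
  exact (integrable_exp_mul_gap_profile hc b).indicator measurableSet_Iic

lemma integral_gapIntegrand {c : ℝ} (hc : 0 < c) (b : ℝ) :
    ∫ p, gapIntegrand c b p
      = ∫ t in Set.Iic b, exp (-c * t ^ 2) * (2 * ((b - t) ^ 2 - 1 + exp (-(b - t) ^ 2))) := by
  rw [Measure.volume_eq_prod, integral_prod _ (integrable_gapIntegrand hc b)]
  simp_rw [integral_gapIntegrand_fiber]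
  rw [integral_indicator measurableSet_Iic]

lemma indicator_midpoint_difference (a b : ℝ) (p : ℝ × ℝ) :
    Set.indicator {q : ℝ × ℝ | q.1 < q.2 ∧ q.2 < b}
        (fun q => exp (-(1 / 2) * (q.1 ^ 2 + q.2 ^ 2) - (a / 2) * (q.1 + q.2) ^ 2)
          * (|q.1 - b| * |q.2 - b|) * |q.1 - q.2|) (p.1 - p.2 / 2, p.1 + p.2 / 2)
      = gapIntegrand (1 + 2 * a) b p := by
  obtain ⟨t, s⟩ := p
  have hiff : t - s / 2 < t + s / 2 ∧ t + s / 2 < b ↔ 0 < s ∧ s < 2 * (b - t) := by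
    constructor <;> rintro ⟨h0, h1⟩ <;> constructor <;> linarith
  simp only [gapIntegrand, Set.indicator_apply, Set.mem_ofPred_eq]
  by_cases h : 0 < s ∧ s < 2 * (b - t)
  · rw [if_pos (hiff.2 h), if_pos h]
    obtain ⟨h0, h1⟩ := h
    rw [abs_of_neg (by linarith : t - s / 2 - b < 0), abs_of_neg (by linarith : t + s / 2 - b < 0),
      abs_of_neg (by linarith : t - s / 2 - (t + s / 2) < 0), ← mul_assoc (exp (-(1 + 2 * a) * t ^ 2)),
      ← mul_assoc (exp (-(1 + 2 * a) * t ^ 2)), ← exp_add]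
    have : -(1 / 2) * ((t - s / 2) ^ 2 + (t + s / 2) ^ 2) - a / 2 * (t - s / 2 + (t + s / 2)) ^ 2
        = -(1 + 2 * a) * t ^ 2 + -s ^ 2 / 4 := by ring
    rw [this]
    ring
  · rw [if_neg (hiff.not.2 h), if_neg h]

/-- For `a > −1/2` and `b ∈ ℝ`, the double integral over `ℝ²` of
`exp{−(1/2)(λ₁² + λ₂²) − (a/2)(λ₁ + λ₂)²}·|λ₁ − b|·|λ₂ − b|·|λ₁ − λ₂|·1{λ₁ < λ₂ < b}`
equals the stated explicit expression. -/
theorem stmt_4 (a b : ℝ) (ha : -(1 / 2) < a) :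
    (∫ p : ℝ × ℝ,
      Set.indicator {q : ℝ × ℝ | q.1 < q.2 ∧ q.2 < b}
        (fun q => Real.exp (-(1 / 2) * (q.1 ^ 2 + q.2 ^ 2) - (a / 2) * (q.1 + q.2) ^ 2)
          * (|q.1 - b| * |q.2 - b|) * |q.1 - q.2|) p)
    = Real.sqrt (2 * Real.pi) / Real.sqrt (1 + a)
        * Real.exp (-((1 + 2 * a) / (2 * (1 + a))) * b ^ 2)
        * stdGaussCDF ((1 + 2 * a) / Real.sqrt (1 + a) * b)
      + (2 * b ^ 2 - (1 + 4 * a) / (1 + 2 * a)) * (Real.sqrt Real.pi / Real.sqrt (1 + 2 * a))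
        * stdGaussCDF (Real.sqrt (2 * (1 + 2 * a)) * b)
      + b / (1 + 2 * a) * Real.exp (-(1 + 2 * a) * b ^ 2) := by
  have hc : 0 < 1 + 2 * a := by linarith
  have ha1 : 0 < 1 + a := by linarith
  have hmp := measurePreserving_midpoint_difference
  rw [← hmp.map_eq, integral_map hmp.measurable.aemeasurable]
  · simp_rw [indicator_midpoint_difference]
    rw [integral_gapIntegrand hc, integral_Iic_exp_mul_gap_profile hc]
    have h2 : 1 + 2 * a + 1 = 2 * (1 + a) := by ring
    have hs : √(1 + a) ^ 2 = 1 + a := sq_sqrt ha1.le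
    have hs4 : √(2 * (2 * (1 + a))) = 2 * √(1 + a) := by
      rw [show 2 * (2 * (1 + a)) = 2 ^ 2 * (1 + a) by ring, sqrt_mul (by norm_num),
        sqrt_sq (by norm_num)]
    have harg : √(2 * (2 * (1 + a))) * (b - b / (2 * (1 + a)))
        = (1 + 2 * a) / √(1 + a) * b := by
      rw [hs4]
      field_simp
      rw [hs]
      ring
    have hpre : 2 * √(π / (2 * (1 + a))) = √(2 * π) / √(1 + a) := by
      rw [← sqrt_div (by positivity), show 2 * π / (1 + a) = 2 ^ 2 * (π / (2 * (1 + a))) by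
        field_simp, sqrt_mul (by norm_num), sqrt_sq (by norm_num)]
    rw [h2, harg, sub_zero, ← hpre, sqrt_div pi_pos.le (1 + 2 * a)]
    field_simp
    ring
  · refine (Measurable.indicator (by fun_prop) ?_).aestronglyMeasurable
    exact (measurableSet_lt measurable_fst measurable_snd).inter
      (measurableSet_lt measurable_snd measurable_const)
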